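/- Let A, B, C be any points on the equator S¹ = {(x,y,0) : x² + y² = 1}, let N = (0,0,1) be the North Pole, and let D be a point of the closed unit upper hemisphere S²_{≥0} with |DN| ≤ 0.07268. Then |AB| + |BC| + |CA| + |AD| + |BD| + |CD| ≤ 3√3 + 3√2 + 3·0.07268 < 4 + 4√2; in particular, such a quadruple (A,B,C,D) does not maximize the sum of the six pairwise distances over quadruples of points of S²_{≥0}. -/

import Mathlib

/-- Euclidean distance between two points of `ℝ × ℝ × ℝ`. -/
noncomputable def dist3 (P Q : ℝ × ℝ × ℝ) : ℝ :=
  Real.sqrt ((P.1 - Q.1) ^ 2 + (P.2.1 - Q.2.1) ^ 2 + (P.2.2 - Q.2.2) ^ 2)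

/-- The closed unit upper hemisphere `S²_{≥0}`. -/
def upperHemisphere : Set (ℝ × ℝ × ℝ) :=
  {p | p.1 ^ 2 + p.2.1 ^ 2 + p.2.2 ^ 2 = 1 ∧ 0 ≤ p.2.2}

/-- The equator `S¹ = {(x, y, 0) : x² + y² = 1}`. -/
def equator : Set (ℝ × ℝ × ℝ) :=
  {p | p.1 ^ 2 + p.2.1 ^ 2 = 1 ∧ p.2.2 = 0}

/-- Sum of the six pairwise distances of a quadruple. -/
noncomputable def sumDist (A B C D : ℝ × ℝ × ℝ) : ℝ :=
  dist3 A B + dist3 B C + dist3 C A + dist3 A D + dist3 B D + dist3 C D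

theorem dist3_nonneg (P Q : ℝ × ℝ × ℝ) : 0 ≤ dist3 P Q := Real.sqrt_nonneg _

theorem dist3_sq (P Q : ℝ × ℝ × ℝ) :
    dist3 P Q ^ 2 = (P.1 - Q.1) ^ 2 + (P.2.1 - Q.2.1) ^ 2 + (P.2.2 - Q.2.2) ^ 2 :=
  Real.sq_sqrt (by positivity)

/-- An inscribed triangle in the unit circle has perimeter at most `3√3`. -/
theorem perimeter_le_of_mem_equator {A B C : ℝ × ℝ × ℝ}
    (hA : A ∈ equator) (hB : B ∈ equator) (hC : C ∈ equator) :
    dist3 A B + dist3 B C + dist3 C A ≤ 3 * Real.sqrt 3 := by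
  obtain ⟨a, a'⟩ := hA
  obtain ⟨b, b'⟩ := hB
  obtain ⟨c, c'⟩ := hC
  have h₁ := dist3_sq A B
  have h₂ := dist3_sq B C
  have h₃ := dist3_sq C A
  rw [a', b'] at h₁
  rw [b', c'] at h₂
  rw [c', a'] at h₃
  have hs : dist3 A B ^ 2 + dist3 B C ^ 2 + dist3 C A ^ 2 ≤ 9 := by
    rw [h₁, h₂, h₃]
    linarith [sq_nonneg (A.1 + B.1 + C.1), sq_nonneg (A.2.1 + B.2.1 + C.2.1)]
  refine abs_le_of_sq_le_sq' ?_ (by positivity) |>.2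
  rw [mul_pow, Real.sq_sqrt (by norm_num)]
  linarith [sq_nonneg (dist3 A B - dist3 B C), sq_nonneg (dist3 B C - dist3 C A),
    sq_nonneg (dist3 C A - dist3 A B)]

/-- The triangle inequality through the North Pole, which is at distance `√2` from the equator. -/
theorem dist3_le_of_dist3_pole_le {A D : ℝ × ℝ × ℝ} {r : ℝ} (hA : A ∈ equator)
    (hD : D ∈ upperHemisphere) (h : dist3 D ((0 : ℝ), (0 : ℝ), (1 : ℝ)) ≤ r) :
    dist3 A D ≤ Real.sqrt 2 + r := by
  obtain ⟨a, a'⟩ := hA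
  have hr : 0 ≤ r := (dist3_nonneg _ _).trans h
  have hsq := pow_le_pow_left₀ (dist3_nonneg _ _) h 2
  rw [dist3_sq] at hsq
  have hd := hD.1
  have hxy : D.1 ^ 2 + D.2.1 ^ 2 ≤ r ^ 2 := by
    linarith [sq_nonneg (D.2.2 - 1)]
  have hdot : (A.1 * D.1 + A.2.1 * D.2.1) ^ 2 ≤ r ^ 2 := by
    have lagrange : (A.1 * D.1 + A.2.1 * D.2.1) ^ 2 + (A.1 * D.2.1 - A.2.1 * D.1) ^ 2
        = (A.1 ^ 2 + A.2.1 ^ 2) * (D.1 ^ 2 + D.2.1 ^ 2) := by ring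
    rw [a] at lagrange
    linarith [sq_nonneg (A.1 * D.2.1 - A.2.1 * D.1)]
  have hlow := (abs_le_of_sq_le_sq' hdot hr).1
  refine abs_le_of_sq_le_sq' ?_ (by positivity) |>.2
  rw [dist3_sq, a', add_sq, Real.sq_sqrt (by norm_num)]
  nlinarith [Real.one_lt_sqrt_two]

/-- The square inscribed in the equator has distance sum `4 + 4√2`. -/
theorem sumDist_equatorial_square :
    sumDist (1, 0, 0) (0, 1, 0) (-1, 0, 0) (0, -1, 0) = 4 + 4 * Real.sqrt 2 := by
  have h4 : Real.sqrt 4 = 2 := by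
    rw [show (4 : ℝ) = 2 ^ 2 by norm_num, Real.sqrt_sq (by norm_num)]
  simp only [sumDist, dist3]
  norm_num [h4]
  ring

theorem three_sqrt_three_add_lt :
    3 * Real.sqrt 3 + 3 * Real.sqrt 2 + 3 * 0.07268 < 4 + 4 * Real.sqrt 2 := by
  have h₃ : Real.sqrt 3 < 1.732052 := (Real.sqrt_lt' (by norm_num)).2 (by norm_num)
  have h₂ : 1.414212 < Real.sqrt 2 := (Real.lt_sqrt (by norm_num)).2 (by norm_num)
  linarith

theorem near_pole_not_optimal
    (A B C D : ℝ × ℝ × ℝ)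
    (hA : A ∈ equator) (hB : B ∈ equator) (hC : C ∈ equator)
    (hD : D ∈ upperHemisphere)
    (hDN : dist3 D ((0 : ℝ), (0 : ℝ), (1 : ℝ)) ≤ 0.07268) :
    sumDist A B C D ≤ 3 * Real.sqrt 3 + 3 * Real.sqrt 2 + 3 * 0.07268 ∧
    3 * Real.sqrt 3 + 3 * Real.sqrt 2 + 3 * 0.07268 < 4 + 4 * Real.sqrt 2 ∧
    ¬ (∀ A' ∈ upperHemisphere, ∀ B' ∈ upperHemisphere,
        ∀ C' ∈ upperHemisphere, ∀ D' ∈ upperHemisphere,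
          sumDist A' B' C' D' ≤ sumDist A B C D) := by
  have hle : sumDist A B C D ≤ 3 * Real.sqrt 3 + 3 * Real.sqrt 2 + 3 * 0.07268 := by
    have hp := perimeter_le_of_mem_equator hA hB hC
    have h₁ := dist3_le_of_dist3_pole_le hA hD hDN
    have h₂ := dist3_le_of_dist3_pole_le hB hD hDN
    have h₃ := dist3_le_of_dist3_pole_le hC hD hDN
    unfold sumDist
    linarith
  refine ⟨hle, three_sqrt_three_add_lt, fun hmax => ?_⟩
  have h := hmax (1, 0, 0) (by norm_num [upperHemisphere]) (0, 1, 0) (by norm_num [upperHemisphere])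
    (-1, 0, 0) (by norm_num [upperHemisphere]) (0, -1, 0) (by norm_num [upperHemisphere])
  rw [sumDist_equatorial_square] at h
  linarith [three_sqrt_three_add_lt]
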